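/- Let G be a simple graph on {1,…,n}, and let G₁ and G₂ be subgraphs of G whose edge sets partition the edge set of G. Suppose that any two vertices lying in the same connected component of G₂ have the same set of neighbors in G₁. Then the multiplication map μ : E_{G₁} ⊗_ℚ E_{G₂} → E_G, determined by P ⊗ Q ↦ PQ, is a ℚ-linear bijection. In particular, for every d ≥ 0, dim_ℚ E_G^d = Σ_{i+j=d} (dim_ℚ E_{G₁}^i)(dim_ℚ E_{G₂}^j). -/

import Mathlib

open scoped TensorProduct

namespace FK

/-- Defining relations of the Fomin–Kirillov algebra `E n`, with generators indexed by
ordered pairs `(i, j)`; we also impose `x_{ii} = 0` and the antisymmetry `x_{ji} = -x_{ij}`,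
so that the generators of the algebra are the `x_{ij}` for `i < j`. -/
inductive Rel (n : ℕ) : FreeAlgebra ℚ (Fin n × Fin n) → FreeAlgebra ℚ (Fin n × Fin n) → Prop
  | diag (i : Fin n) : Rel n (FreeAlgebra.ι ℚ (i, i)) 0
  | antisymm (i j : Fin n) (hij : i ≠ j) :
      Rel n (FreeAlgebra.ι ℚ (j, i)) (-FreeAlgebra.ι ℚ (i, j))
  | square (i j : Fin n) (hij : i ≠ j) :
      Rel n (FreeAlgebra.ι ℚ (i, j) * FreeAlgebra.ι ℚ (i, j)) 0
  | comm (i j k l : Fin n) (h : List.Nodup [i, j, k, l]) :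
      Rel n (FreeAlgebra.ι ℚ (i, j) * FreeAlgebra.ι ℚ (k, l))
        (FreeAlgebra.ι ℚ (k, l) * FreeAlgebra.ι ℚ (i, j))
  | cyclic (i j k : Fin n) (h : List.Nodup [i, j, k]) :
      Rel n (FreeAlgebra.ι ℚ (i, j) * FreeAlgebra.ι ℚ (j, k)
        + FreeAlgebra.ι ℚ (j, k) * FreeAlgebra.ι ℚ (k, i)
        + FreeAlgebra.ι ℚ (k, i) * FreeAlgebra.ι ℚ (i, j)) 0

/-- The Fomin–Kirillov algebra `E n`. -/
abbrev E (n : ℕ) : Type := RingQuot (Rel n)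

/-- The generator `x_{ij}` of `E n`. -/
noncomputable def x (n : ℕ) (i j : Fin n) : E n :=
  RingQuot.mkAlgHom ℚ (Rel n) (FreeAlgebra.ι ℚ (i, j))

/-- The product of generators `x_{i₁j₁} ⋯ x_{i_d j_d}` given by a list of pairs. -/
noncomputable def word (n : ℕ) (l : List (Fin n × Fin n)) : E n :=
  (l.map fun p => x n p.1 p.2).prod

/-- The degree-`d` component of `E n`: the span of products of `d` generators. -/
def degSpan (n : ℕ) (d : ℕ) : Submodule ℚ (E n) :=
  Submodule.span ℚ {y | ∃ l : List (Fin n × Fin n),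
    (∀ p ∈ l, p.1 ≠ p.2) ∧ l.length = d ∧ y = word n l}

/-- The Fomin–Kirillov algebra of a graph `G`: the subalgebra of `E n` generated by the
`x_{ij}` with `{i,j}` an edge of `G`. -/
def EG (n : ℕ) (G : SimpleGraph (Fin n)) : Subalgebra ℚ (E n) :=
  Algebra.adjoin ℚ {y | ∃ i j : Fin n, G.Adj i j ∧ y = x n i j}

/-- The degree-`d` component `E_G^d = E_G ∩ E_n^d`. -/
def EGdeg (n : ℕ) (G : SimpleGraph (Fin n)) (d : ℕ) : Submodule ℚ (E n) :=
  (EG n G).toSubmodule ⊓ degSpan n d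

/-- The positive-degree part `E_G⁺` of `E_G`. -/
def EGplus (n : ℕ) (G : SimpleGraph (Fin n)) : Submodule ℚ (E n) :=
  ⨆ d : ℕ, ⨆ _ : 1 ≤ d, EGdeg n G d


/-- The `ℚ`-linear multiplication map `A ⊗[ℚ] B → E n`, `P ⊗ Q ↦ PQ`, for subalgebras
`A`, `B` of `E n`. -/
noncomputable def mulMap (n : ℕ) (A B : Subalgebra ℚ (E n)) :
    (↥A ⊗[ℚ] ↥B) →ₗ[ℚ] E n :=
  TensorProduct.lift
    { toFun := fun p =>
        { toFun := fun q => (p : E n) * (q : E n)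
          map_add' := by intro q q'; simp [mul_add]
          map_smul' := by intro c q; simp [mul_smul_comm] }
      map_add' := by intro p p'; ext q; simp [add_mul]
      map_smul' := by intro c p; ext q; simp [smul_mul_assoc] }


section Basics

/-- Over `ℚ` every semimodule is a module, hence free. -/
instance free_rat {M : Type*} [AddCommMonoid M] [Module ℚ M] : Module.Free ℚ M :=
  letI := Module.addCommMonoidToAddCommGroup ℚ (M := M)
  Module.Free.of_divisionRing ℚ M

theorem inj_of_ker {M N : Type*} [AddCommMonoid M] [Module ℚ M] [AddCommMonoid N] [Module ℚ N]
    (f : M →ₗ[ℚ] N) (h : ∀ a, f a = 0 → a = 0) : Function.Injective f := by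
  letI := Module.addCommMonoidToAddCommGroup ℚ (M := M)
  letI := Module.addCommMonoidToAddCommGroup ℚ (M := N)
  exact (injective_iff_map_eq_zero f).2 h

variable {n : ℕ}

theorem x_self (i : Fin n) : x n i i = 0 := by
  have h := RingQuot.mkAlgHom_rel ℚ (Rel.diag (n := n) i)
  simpa [x] using h

theorem x_anti (i j : Fin n) : x n j i = (-1 : ℚ) • x n i j := by
  by_cases hij : i = j
  · subst hij; simp [x_self]
  · have h := RingQuot.mkAlgHom_rel ℚ (Rel.antisymm (n := n) i j hij)
    have e : -FreeAlgebra.ι ℚ (i, j) = (-1 : ℚ) • FreeAlgebra.ι ℚ (i, j) := by simp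
    rw [e, map_smul] at h
    exact h

theorem x_sq (i j : Fin n) : x n i j * x n i j = 0 := by
  by_cases hij : i = j
  · subst hij; simp [x_self]
  · have h := RingQuot.mkAlgHom_rel ℚ (Rel.square (n := n) i j hij)
    simpa [x] using h

theorem x_comm (i j k l : Fin n) (hh : List.Nodup [i, j, k, l]) :
    x n i j * x n k l = x n k l * x n i j := by
  have h := RingQuot.mkAlgHom_rel ℚ (Rel.comm (n := n) i j k l hh)
  simpa [x] using h

theorem x_cyc (i j k : Fin n) (hh : List.Nodup [i, j, k]) :
    x n i j * x n j k + x n j k * x n k i + x n k i * x n i j = 0 := by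
  have h := RingQuot.mkAlgHom_rel ℚ (Rel.cyclic (n := n) i j k hh)
  simpa [x] using h

/-- The relations, as a predicate on a family of elements of an algebra. -/
structure Good {A : Type*} [Semiring A] [Module ℚ A] (f : Fin n → Fin n → A) : Prop where
  diag : ∀ i, f i i = 0
  anti : ∀ i j, i ≠ j → f j i = (-1 : ℚ) • f i j
  sq : ∀ i j, i ≠ j → f i j * f i j = 0
  comm : ∀ i j k l, List.Nodup [i, j, k, l] → f i j * f k l = f k l * f i j
  cyc : ∀ i j k, List.Nodup [i, j, k] → f i j * f j k + f j k * f k i + f k i * f i j = 0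

/-- Universal property of `E n`. -/
noncomputable def liftE {A : Type*} [Semiring A] [Algebra ℚ A] (f : Fin n → Fin n → A)
    (hf : Good f) : E n →ₐ[ℚ] A :=
  RingQuot.liftAlgHom ℚ ⟨FreeAlgebra.lift ℚ (fun p => f p.1 p.2), by
    intro a b h
    cases h with
    | diag i => simpa using hf.diag i
    | antisymm i j hij =>
      have e : -FreeAlgebra.ι ℚ (i, j) = (-1 : ℚ) • FreeAlgebra.ι ℚ (i, j) := by simp
      rw [e, map_smul]
      simpa only [FreeAlgebra.lift_ι_apply] using hf.anti i j hij
    | square i j hij => simpa using hf.sq i j hij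
    | comm i j k l h => simpa using hf.comm i j k l h
    | cyclic i j k h => simpa using hf.cyc i j k h⟩

@[simp] theorem liftE_x {A : Type*} [Semiring A] [Algebra ℚ A] (f : Fin n → Fin n → A)
    (hf : Good f) (i j : Fin n) : liftE f hf (x n i j) = f i j := by
  simp [liftE, x]

@[simp] theorem word_nil : word n [] = 1 := by simp [word]

@[simp] theorem word_cons (p : Fin n × Fin n) (l : List (Fin n × Fin n)) :
    word n (p :: l) = x n p.1 p.2 * word n l := by simp [word]

theorem word_append (l l' : List (Fin n × Fin n)) :
    word n (l ++ l') = word n l * word n l' := by simp [word]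

/-- The words in the edges of `G` span `E_G`. -/
theorem EG_eq_span (G : SimpleGraph (Fin n)) : (EG n G).toSubmodule =
    Submodule.span ℚ {y | ∃ l : List (Fin n × Fin n), (∀ p ∈ l, G.Adj p.1 p.2) ∧ y = word n l} := by
  rw [EG, Algebra.adjoin_eq_span]
  congr 1
  ext y
  constructor
  · intro hy
    induction hy using Submonoid.closure_induction with
    | mem y hy =>
      obtain ⟨i, j, h, rfl⟩ := hy
      exact ⟨[(i, j)], by simpa using h, by simp⟩
    | one => exact ⟨[], by simp, by simp⟩
    | mul a b _ _ ha hb =>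
      obtain ⟨l, hl, rfl⟩ := ha
      obtain ⟨l', hl', rfl⟩ := hb
      refine ⟨l ++ l', ?_, (word_append l l').symm⟩
      intro p hp
      rcases List.mem_append.1 hp with h | h
      · exact hl p h
      · exact hl' p h
  · rintro ⟨l, hl, rfl⟩
    refine Submonoid.list_prod_mem _ ?_
    intro a ha
    obtain ⟨p, hp, rfl⟩ := List.mem_map.1 ha
    exact Submonoid.subset_closure ⟨p.1, p.2, hl p hp, rfl⟩

theorem x_mem_EG {G : SimpleGraph (Fin n)} {i j : Fin n} (h : G.Adj i j) : x n i j ∈ EG n G :=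
  Algebra.subset_adjoin ⟨i, j, h, rfl⟩

theorem EG_mono {G H : SimpleGraph (Fin n)} (h : ∀ i j, G.Adj i j → H.Adj i j) :
    EG n G ≤ EG n H := by
  apply Algebra.adjoin_mono
  rintro y ⟨i, j, hij, rfl⟩
  exact ⟨i, j, h i j hij, rfl⟩

theorem word_mem_EG {G : SimpleGraph (Fin n)} {l : List (Fin n × Fin n)}
    (hl : ∀ p ∈ l, G.Adj p.1 p.2) : word n l ∈ EG n G := by
  refine Subalgebra.list_prod_mem _ ?_
  intro a ha
  obtain ⟨p, hp, rfl⟩ := List.mem_map.1 ha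
  exact x_mem_EG (hl p hp)

/-! ### The grading -/

theorem good_grade : Good (fun i j : Fin n => (Polynomial.C (x n i j) * Polynomial.X :
    Polynomial (E n))) := by
  have key : ∀ a b : E n, (Polynomial.C a * Polynomial.X) * (Polynomial.C b * Polynomial.X) =
      Polynomial.C (a * b) * Polynomial.X ^ 2 := by
    intro a b
    rw [mul_assoc, ← mul_assoc Polynomial.X, Polynomial.X_mul_C, mul_assoc, ← mul_assoc,
      ← Polynomial.C_mul, sq]
  constructor
  · intro i; simp [x_self]
  · intro i j _
    simp only [x_anti i j]
    rw [← Polynomial.smul_C, smul_mul_assoc]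
  · intro i j _; rw [key, x_sq]; simp
  · intro i j k l h; rw [key, key, x_comm i j k l h]
  · intro i j k h
    rw [key, key, key, ← add_mul, ← add_mul, ← Polynomial.C_add, ← Polynomial.C_add, x_cyc i j k h]
    simp

/-- The grading homomorphism `x_{ij} ↦ x_{ij} t`. -/
noncomputable def grade (n : ℕ) : E n →ₐ[ℚ] Polynomial (E n) := liftE _ good_grade

theorem grade_word (l : List (Fin n × Fin n)) :
    grade n (word n l) = Polynomial.C (word n l) * Polynomial.X ^ l.length := by
  induction l with
  | nil => simp
  | cons p l ih =>
    rw [word_cons, map_mul, ih, grade, liftE_x, List.length_cons, pow_succ', Polynomial.C_mul]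
    simp only [mul_assoc]
    congr 1
    rw [← mul_assoc, Polynomial.X_mul_C, mul_assoc]

/-- The degree-`d` component of an element. -/
noncomputable def comp (n d : ℕ) : E n →ₗ[ℚ] E n where
  toFun a := (grade n a).coeff d
  map_add' a b := by simp
  map_smul' c a := by simp

theorem comp_apply (d : ℕ) (a : E n) : comp n d a = (grade n a).coeff d := rfl

theorem comp_word (d : ℕ) (l : List (Fin n × Fin n)) :
    comp n d (word n l) = if l.length = d then word n l else 0 := by
  rw [comp_apply, grade_word, Polynomial.coeff_C_mul, Polynomial.coeff_X_pow]
  simp [eq_comm]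

theorem comp_mul (d : ℕ) (a b : E n) :
    comp n d (a * b) = ∑ p ∈ Finset.HasAntidiagonal.antidiagonal d, comp n p.1 a * comp n p.2 b := by
  simp [comp_apply, Polynomial.coeff_mul]

theorem comp_of_mem {d : ℕ} {a : E n} (ha : a ∈ degSpan n d) (e : ℕ) :
    comp n e a = if d = e then a else 0 := by
  induction ha using Submodule.span_induction with
  | mem a ha =>
    obtain ⟨l, _, rfl, rfl⟩ := ha
    exact comp_word e l
  | zero => simp
  | add a b _ _ ha hb => rw [map_add, ha, hb]; split_ifs <;> simp
  | smul c a _ ha => rw [map_smul, ha]; split_ifs <;> simp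

theorem comp_mem (G : SimpleGraph (Fin n)) (d : ℕ) {a : E n} (ha : a ∈ EG n G) :
    comp n d a ∈ EGdeg n G d := by
  have ha' : a ∈ (EG n G).toSubmodule := ha
  rw [EG_eq_span] at ha'
  clear ha
  induction ha' using Submodule.span_induction with
  | mem a hl =>
    obtain ⟨l, hl, rfl⟩ := hl
    have ha : word n l ∈ EG n G := word_mem_EG hl
    rw [comp_word]
    split_ifs with h
    · exact ⟨ha, Submodule.subset_span ⟨l, fun p hp => (hl p hp).ne, h, rfl⟩⟩
    · exact zero_mem _
  | zero => simp
  | add a b _ _ ha hb => rw [map_add]; exact add_mem ha hb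
  | smul c a _ ha => rw [map_smul]; exact Submodule.smul_mem _ _ ha

theorem degSpan_mul {d e : ℕ} {a b : E n} (ha : a ∈ degSpan n d) (hb : b ∈ degSpan n e) :
    a * b ∈ degSpan n (d + e) := by
  have h : a * b ∈ degSpan n d * degSpan n e := Submodule.mul_mem_mul ha hb
  rw [degSpan, degSpan, Submodule.span_mul_span] at h
  refine Submodule.span_mono ?_ h
  rintro _ ⟨_, ⟨l, hl, rfl, rfl⟩, _, ⟨l', hl', rfl, rfl⟩, rfl⟩
  refine ⟨l ++ l', ?_, by simp, (word_append l l').symm⟩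
  intro p hp
  rcases List.mem_append.1 hp with h | h
  · exact hl p h
  · exact hl' p h

instance degSpan_finite (d : ℕ) : Module.Finite ℚ (degSpan n d) := by
  apply Module.Finite.span_of_finite
  refine Set.Finite.subset ((List.finite_length_eq (Fin n × Fin n) d).image (word n)) ?_
  rintro _ ⟨l, _, hl, rfl⟩
  exact ⟨l, hl, rfl⟩

instance EGdeg_finite (G : SimpleGraph (Fin n)) (d : ℕ) : Module.Finite ℚ (EGdeg n G d) :=
  Submodule.finiteDimensional_of_le (inf_le_right : _ ≤ degSpan n d)

/-! ### The action of the symmetric group -/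

theorem good_act (σ : Equiv.Perm (Fin n)) : Good (fun i j : Fin n => x n (σ i) (σ j)) := by
  constructor
  · intro i; exact x_self _
  · intro i j _; exact x_anti _ _
  · intro i j _; exact x_sq _ _
  · intro i j k l h
    refine x_comm _ _ _ _ ?_
    have := h.map σ.injective
    simpa using this
  · intro i j k h
    refine x_cyc _ _ _ ?_
    have := h.map σ.injective
    simpa using this

/-- The action of a permutation as a linear endomorphism. -/
noncomputable def act (σ : Equiv.Perm (Fin n)) : Module.End ℚ (E n) :=
  (liftE _ (good_act σ)).toLinearMap

theorem E_hom_ext {A : Type*} [Semiring A] [Algebra ℚ A] {f g : E n →ₐ[ℚ] A}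
    (h : ∀ i j, f (x n i j) = g (x n i j)) : f = g := by
  apply RingQuot.ringQuot_ext'
  apply FreeAlgebra.hom_ext
  funext p
  exact h p.1 p.2

theorem act_mul (σ τ : Equiv.Perm (Fin n)) : act σ * act τ = act (σ * τ) := by
  have : (liftE _ (good_act σ)).comp (liftE _ (good_act τ)) = liftE _ (good_act (σ * τ)) := by
    apply E_hom_ext
    intro i j
    simp
  ext a
  exact DFunLike.congr_fun this a

theorem act_one (σ : Equiv.Perm (Fin n)) : act σ (1 : E n) = 1 := by
  simp [act]

/-- Left multiplication by a generator. -/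
noncomputable def L (a : E n) : Module.End ℚ (E n) := Algebra.lmul ℚ (E n) a

theorem L_mul (a b : E n) : L (a * b) = L a * L b := map_mul _ _ _
theorem L_add (a b : E n) : L (a + b) = L a + L b := map_add _ _ _
theorem L_smul (c : ℚ) (a : E n) : L (c • a) = c • L a := map_smul _ _ _
theorem L_zero : L (0 : E n) = 0 := map_zero _

theorem act_L (σ : Equiv.Perm (Fin n)) (i j : Fin n) :
    act σ * L (x n i j) = L (x n (σ i) (σ j)) * act σ := by
  ext a
  simp [act, L]

/-! ### The coaction -/

theorem cancel {M : Type*} [AddCommMonoid M] [Module ℚ M] (a : M) : a + (-1 : ℚ) • a = 0 := by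
  nth_rewrite 1 [← one_smul ℚ a]
  rw [← add_smul]
  simp


/-- The truncated generators: `x_{ij}` if `i ~ j` and zero otherwise. -/
noncomputable def trunc (s : Setoid (Fin n)) (i j : Fin n) : E n :=
  open scoped Classical in if s i j then x n i j else 0

theorem trunc_of {s : Setoid (Fin n)} {i j : Fin n} (h : s i j) : trunc s i j = x n i j := by
  simp [trunc, h]

theorem trunc_of_not {s : Setoid (Fin n)} {i j : Fin n} (h : ¬ s i j) : trunc s i j = 0 := by
  simp [trunc, h]

theorem good_trunc (s : Setoid (Fin n)) : Good (trunc s) := by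
  constructor
  · intro i; simp [trunc, x_self]
  · intro i j _
    by_cases h : s i j
    · rw [trunc_of h, trunc_of (s.symm h), x_anti]
    · rw [trunc_of_not h, trunc_of_not (fun h' => h (s.symm h'))]; simp
  · intro i j _
    by_cases h : s i j
    · rw [trunc_of h, x_sq]
    · rw [trunc_of_not h]; simp
  · intro i j k l hh
    by_cases h : s i j
    · by_cases h' : s k l
      · rw [trunc_of h, trunc_of h', x_comm i j k l hh]
      · rw [trunc_of_not h']; simp
    · rw [trunc_of_not h]; simp
  · intro i j k hh
    by_cases h1 : s i j
    · by_cases h2 : s j k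
      · rw [trunc_of h1, trunc_of h2, trunc_of (s.symm (s.trans h1 h2)), x_cyc i j k hh]
      · have h3 : ¬ s k i := fun h3 => h2 (s.symm (s.trans h3 h1))
        rw [trunc_of_not h2, trunc_of_not h3]; simp
    · by_cases h2 : s j k
      · have h3 : ¬ s k i := fun h3 => h1 (s.symm (s.trans h2 h3))
        rw [trunc_of_not h1, trunc_of_not h3]; simp
      · rw [trunc_of_not h1, trunc_of_not h2]; simp

/-- The value of the coaction on generators. -/
noncomputable def coactGen (s : Setoid (Fin n)) (i j : Fin n) : Module.End ℚ (E n) ⊗[ℚ] E n :=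
  L (x n i j) ⊗ₜ 1 + act (Equiv.swap i j) ⊗ₜ trunc s i j

theorem act_swap_cyc (i j k : Fin n) (h : List.Nodup [i, j, k]) :
    act (Equiv.swap i j) * act (Equiv.swap j k) = act (Equiv.swap k i) * act (Equiv.swap i j) := by
  simp only [List.nodup_cons, List.mem_cons, List.not_mem_nil, or_false, not_or] at h
  obtain ⟨⟨h1, h2⟩, h3, -⟩ := h
  rw [act_mul, act_mul, Equiv.mul_swap_eq_swap_mul, Equiv.swap_apply_right,
    Equiv.swap_apply_of_ne_of_ne (Ne.symm h2) (Ne.symm h3), Equiv.swap_comm i k]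

theorem act_swap_L (i j k : Fin n) (h : List.Nodup [i, j, k]) :
    act (Equiv.swap i j) * L (x n j k) = (-1 : ℚ) • (L (x n k i) * act (Equiv.swap i j)) := by
  simp only [List.nodup_cons, List.mem_cons, List.not_mem_nil, or_false, not_or] at h
  obtain ⟨⟨h1, h2⟩, h3, -⟩ := h
  rw [act_L, Equiv.swap_apply_right, Equiv.swap_apply_of_ne_of_ne (Ne.symm h2) (Ne.symm h3),
    x_anti k i, L_smul, smul_mul_assoc]

theorem nodup_rot {i j k : Fin n} (h : List.Nodup [i, j, k]) : List.Nodup [j, k, i] := by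
  simp only [List.nodup_cons, List.mem_cons, List.not_mem_nil, or_false, not_or] at h ⊢
  grind

theorem good_coact (s : Setoid (Fin n)) : Good (coactGen s) := by
  have ht := good_trunc s
  constructor
  · intro i; simp [coactGen, x_self, ht.diag, L_zero]
  · intro i j h
    rw [coactGen, coactGen, ht.anti i j h, x_anti i j, L_smul, Equiv.swap_comm j i,
      ← TensorProduct.smul_tmul', TensorProduct.tmul_smul, smul_add]
  · intro i j h
    simp only [coactGen, mul_add, add_mul, Algebra.TensorProduct.tmul_mul_tmul, ht.sq i j h,
      ← L_mul, x_sq, L_zero, mul_one, one_mul, TensorProduct.zero_tmul, TensorProduct.tmul_zero,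
      act_L, Equiv.swap_apply_left, Equiv.swap_apply_right]
    rw [x_anti i j, L_smul, smul_mul_assoc, zero_add, add_zero, add_comm, ← TensorProduct.add_tmul,
      cancel, TensorProduct.zero_tmul]
  · intro i j k l h
    have h' := h
    simp only [List.nodup_cons, List.mem_cons, List.not_mem_nil, or_false, not_or] at h'
    obtain ⟨⟨h1, h2, h3⟩, ⟨h4, h5⟩, h6, -⟩ := h'
    have e1 : act (Equiv.swap i j) * L (x n k l) = L (x n k l) * act (Equiv.swap i j) := by
      rw [act_L, Equiv.swap_apply_of_ne_of_ne (Ne.symm h2) (Ne.symm h4),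
        Equiv.swap_apply_of_ne_of_ne (Ne.symm h3) (Ne.symm h5)]
    have e2 : act (Equiv.swap k l) * L (x n i j) = L (x n i j) * act (Equiv.swap k l) := by
      rw [act_L, Equiv.swap_apply_of_ne_of_ne h2 h3, Equiv.swap_apply_of_ne_of_ne h4 h5]
    have e3 : act (Equiv.swap i j) * act (Equiv.swap k l) =
        act (Equiv.swap k l) * act (Equiv.swap i j) := by
      rw [act_mul, act_mul, Equiv.mul_swap_eq_swap_mul,
        Equiv.swap_apply_of_ne_of_ne (Ne.symm h2) (Ne.symm h4),
        Equiv.swap_apply_of_ne_of_ne (Ne.symm h3) (Ne.symm h5)]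
    simp only [coactGen, mul_add, add_mul, Algebra.TensorProduct.tmul_mul_tmul, mul_one, one_mul,
      e1, e2, e3, ht.comm i j k l h, ← L_mul, x_comm i j k l h]
    abel
  · intro i j k h
    have hb := nodup_rot h
    have hc := nodup_rot hb
    have t := ht.cyc i j k h
    have tx := x_cyc i j k h
    simp only [coactGen, mul_add, add_mul, Algebra.TensorProduct.tmul_mul_tmul, mul_one, one_mul,
      act_swap_L i j k h, act_swap_L j k i hb, act_swap_L k i j hc, ← TensorProduct.smul_tmul']
    rw [act_swap_cyc j k i hb, act_swap_cyc i j k h]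
    have a1 : (L (x n i j) * L (x n j k)) ⊗ₜ[ℚ] (1 : E n) + (L (x n j k) * L (x n k i)) ⊗ₜ 1 +
        (L (x n k i) * L (x n i j)) ⊗ₜ 1 = 0 := by
      rw [← TensorProduct.add_tmul, ← TensorProduct.add_tmul, ← L_mul, ← L_mul, ← L_mul, ← L_add,
        ← L_add, tx, L_zero, TensorProduct.zero_tmul]
    have a2 : (act (Equiv.swap k i) * act (Equiv.swap i j)) ⊗ₜ[ℚ] (trunc s i j * trunc s j k) +
        (act (Equiv.swap k i) * act (Equiv.swap i j)) ⊗ₜ (trunc s j k * trunc s k i) +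
        (act (Equiv.swap k i) * act (Equiv.swap i j)) ⊗ₜ (trunc s k i * trunc s i j) = 0 := by
      rw [← TensorProduct.tmul_add, ← TensorProduct.tmul_add, t, TensorProduct.tmul_zero]
    have c1 := cancel ((L (x n i j) * act (Equiv.swap j k)) ⊗ₜ[ℚ] trunc s j k)
    have c2 := cancel ((L (x n j k) * act (Equiv.swap k i)) ⊗ₜ[ℚ] trunc s k i)
    have c3 := cancel ((L (x n k i) * act (Equiv.swap i j)) ⊗ₜ[ℚ] trunc s i j)
    have hsum := congrArg₂ (· + ·) (congrArg₂ (· + ·) (congrArg₂ (· + ·)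
      (congrArg₂ (· + ·) a1 a2) c1) c2) c3
    simp only [add_zero] at hsum
    rw [← hsum]
    abel

/-- The coaction `E n → End(E n) ⊗ E n`. -/
noncomputable def coact (s : Setoid (Fin n)) : E n →ₐ[ℚ] Module.End ℚ (E n) ⊗[ℚ] E n :=
  liftE _ (good_coact s)

/-- Evaluate the first factor at `1`. -/
noncomputable def ev (n : ℕ) : Module.End ℚ (E n) ⊗[ℚ] E n →ₗ[ℚ] E n ⊗[ℚ] E n :=
  LinearMap.rTensor (E n) (LinearMap.applyₗ (1 : E n))

/-- The component map on the second factor. -/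
noncomputable def cmp (n d : ℕ) : E n ⊗[ℚ] E n →ₗ[ℚ] E n ⊗[ℚ] E n :=
  LinearMap.lTensor (E n) (comp n d)

theorem comp_x_mul (d : ℕ) (i j : Fin n) (a : E n) :
    comp n (d + 1) (x n i j * a) = x n i j * comp n d a := by
  rw [comp_apply, map_mul, grade, liftE_x, mul_assoc, Polynomial.coeff_C_mul,
    Polynomial.coeff_X_mul]
  rfl

theorem coact_word (s : Setoid (Fin n)) (l : List (Fin n × Fin n)) (hl : ∀ p ∈ l, s p.1 p.2) :
    ∃ (σ : Equiv.Perm (Fin n)) (z : Module.End ℚ (E n) ⊗[ℚ] E n),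
      coact s (word n l) = act σ ⊗ₜ word n l + z ∧
      ∀ d, l.length ≤ d → LinearMap.lTensor (Module.End ℚ (E n)) (comp n d) z = 0 := by
  induction l with
  | nil =>
    refine ⟨1, 0, ?_, by simp⟩
    have h1 : act (1 : Equiv.Perm (Fin n)) = 1 := by
      have : liftE _ (good_act (1 : Equiv.Perm (Fin n))) = AlgHom.id ℚ (E n) := by
        apply E_hom_ext
        intro i j
        simp
      ext a
      exact DFunLike.congr_fun this a
    rw [word_nil, h1, add_zero]
    exact (coact s).map_one'
  | cons p l ih =>
    obtain ⟨σ, z, hz, hd⟩ := ih (fun q hq => hl q (List.mem_cons_of_mem _ hq))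
    refine ⟨Equiv.swap p.1 p.2 * σ, L (x n p.1 p.2) ⊗ₜ[ℚ] 1 * (act σ ⊗ₜ[ℚ] word n l) +
      (L (x n p.1 p.2) ⊗ₜ[ℚ] 1 * z + act (Equiv.swap p.1 p.2) ⊗ₜ[ℚ] x n p.1 p.2 * z), ?_, ?_⟩
    · rw [word_cons, map_mul, hz, coact, liftE_x, coactGen, trunc_of (hl p (by simp)), ← act_mul,
        ← Algebra.TensorProduct.tmul_mul_tmul, mul_add, add_mul, add_mul]
      abel
    · intro d hld
      obtain ⟨d, rfl⟩ : ∃ e, d = e + 1 := ⟨d - 1, by simp at hld; omega⟩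
      simp only [List.length_cons, add_le_add_iff_right] at hld
      have e1 : ∀ z : Module.End ℚ (E n) ⊗[ℚ] E n,
          LinearMap.lTensor (Module.End ℚ (E n)) (comp n (d + 1)) (L (x n p.1 p.2) ⊗ₜ[ℚ] 1 * z) =
          L (x n p.1 p.2) ⊗ₜ[ℚ] 1 * LinearMap.lTensor (Module.End ℚ (E n)) (comp n (d + 1)) z := by
        intro z
        induction z using TensorProduct.induction_on with
        | zero => simp
        | tmul f a => simp
        | add a b ha hb => rw [mul_add, map_add, map_add, ha, hb, mul_add]
      have e2 : ∀ z : Module.End ℚ (E n) ⊗[ℚ] E n,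
          LinearMap.lTensor (Module.End ℚ (E n)) (comp n (d + 1))
            (act (Equiv.swap p.1 p.2) ⊗ₜ[ℚ] x n p.1 p.2 * z) =
          act (Equiv.swap p.1 p.2) ⊗ₜ[ℚ] x n p.1 p.2 *
            LinearMap.lTensor (Module.End ℚ (E n)) (comp n d) z := by
        intro z
        induction z using TensorProduct.induction_on with
        | zero => simp
        | tmul f a => simp [comp_x_mul]
        | add a b ha hb => rw [mul_add, map_add, map_add, ha, hb, mul_add]
      rw [map_add, map_add, e1, e1, e2, hd d hld, hd (d + 1) (by omega), LinearMap.lTensor_tmul,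
        comp_word, if_neg (by omega)]
      simp

/-- `P ⊗ Q ↦ P Q₍₁₎ ⊗ Q₍₂₎`. -/
noncomputable def T (s : Setoid (Fin n)) : E n ⊗[ℚ] E n →ₗ[ℚ] E n ⊗[ℚ] E n :=
  TensorProduct.lift
    { toFun := fun P => LinearMap.rTensor (E n) (L P) ∘ₗ ev n ∘ₗ (coact s).toLinearMap
      map_add' := by intro a b; ext; simp [L_add, LinearMap.rTensor_add]
      map_smul' := by intro a b; ext; simp [L_smul, LinearMap.rTensor_smul] }

theorem T_tmul (s : Setoid (Fin n)) (P Q : E n) :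
    T s (P ⊗ₜ Q) = LinearMap.rTensor (E n) (L P) (ev n (coact s Q)) := rfl

theorem ev_L_mul (P : E n) (z : Module.End ℚ (E n) ⊗[ℚ] E n) :
    ev n (L P ⊗ₜ[ℚ] 1 * z) = LinearMap.rTensor (E n) (L P) (ev n z) := by
  induction z using TensorProduct.induction_on with
  | zero => simp
  | tmul f a => simp [ev]
  | add a b ha hb => rw [mul_add, map_add, map_add, ha, hb, map_add]

theorem cmp_ev (d : ℕ) (z : Module.End ℚ (E n) ⊗[ℚ] E n) :
    cmp n d (ev n z) = ev n (LinearMap.lTensor _ (comp n d) z) := by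
  induction z using TensorProduct.induction_on with
  | zero => simp
  | tmul f a => simp [ev, cmp]
  | add a b ha hb => simp only [map_add, ha, hb]

theorem cmp_rTensor (d : ℕ) (f : Module.End ℚ (E n)) (z : E n ⊗[ℚ] E n) :
    cmp n d (LinearMap.rTensor (E n) f z) = LinearMap.rTensor (E n) f (cmp n d z) := by
  induction z using TensorProduct.induction_on with
  | zero => simp
  | tmul f a => simp [cmp]
  | add a b ha hb => simp only [map_add, ha, hb]

theorem cmp_T_word (s : Setoid (Fin n)) (P : E n) (l : List (Fin n × Fin n))
    (hl : ∀ p ∈ l, s p.1 p.2) (d : ℕ) (hd : l.length ≤ d) :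
    cmp n d (T s (P ⊗ₜ word n l)) = if l.length = d then P ⊗ₜ word n l else 0 := by
  obtain ⟨σ, z, hz, hzd⟩ := coact_word s l hl
  rw [T_tmul, cmp_rTensor, hz, map_add, map_add, cmp_ev d z, hzd d hd, map_zero, add_zero]
  simp only [ev, cmp, LinearMap.rTensor_tmul, LinearMap.lTensor_tmul, comp_word,
    LinearMap.applyₗ_apply_apply, act_one]
  split_ifs <;> simp [L]

theorem coact_EG (s : Setoid (Fin n)) (G : SimpleGraph (Fin n))
    (hG : ∀ i j, G.Adj i j → ¬ s i j) {P : E n} (hP : P ∈ EG n G) :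
    coact s P = L P ⊗ₜ 1 := by
  induction hP using Algebra.adjoin_induction with
  | mem a ha =>
    obtain ⟨i, j, h, rfl⟩ := ha
    simp [coact, coactGen, trunc_of_not (hG i j h)]
  | algebraMap r =>
    rw [AlgHom.commutes, L, AlgHom.commutes, Algebra.TensorProduct.algebraMap_apply]
  | add a b _ _ ha hb => rw [map_add, ha, hb, L_add, TensorProduct.add_tmul]
  | mul a b _ _ ha hb =>
    rw [map_mul, ha, hb, L_mul, Algebra.TensorProduct.tmul_mul_tmul, mul_one]

/-- The inclusion `A ⊗ B → E ⊗ E`. -/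
noncomputable def incl (A B : Subalgebra ℚ (E n)) : (↥A ⊗[ℚ] ↥B) →ₗ[ℚ] E n ⊗[ℚ] E n :=
  TensorProduct.map A.val.toLinearMap B.val.toLinearMap

theorem incl_injective (A B : Subalgebra ℚ (E n)) : Function.Injective (incl A B) := by
  apply TensorProduct.map_injective_of_flat_flat
  · exact Subtype.val_injective
  · exact Subtype.val_injective

theorem mulMap_tmul (A B : Subalgebra ℚ (E n)) (P : A) (Q : B) :
    mulMap n A B (P ⊗ₜ Q) = (P : E n) * (Q : E n) := rfl

theorem T_incl (s : Setoid (Fin n)) (G : SimpleGraph (Fin n))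
    (hG : ∀ i j, G.Adj i j → ¬ s i j) (B : Subalgebra ℚ (E n)) (t : ↥(EG n G) ⊗[ℚ] ↥B) :
    T s (incl _ _ t) = ev n (coact s (mulMap n (EG n G) B t)) := by
  induction t using TensorProduct.induction_on with
  | zero => simp
  | tmul P Q =>
    rw [mulMap_tmul, map_mul, coact_EG s G hG P.2, ev_L_mul]
    rfl
  | add a b ha hb => simp only [map_add, ha, hb]

theorem incl_ind (A : Subalgebra ℚ (E n)) (G : SimpleGraph (Fin n))
    (p : E n ⊗[ℚ] E n → Prop) (h0 : p 0) (ha : ∀ a b, p a → p b → p (a + b))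
    (hb : ∀ (P : E n) (l : List (Fin n × Fin n)), (∀ q ∈ l, G.Adj q.1 q.2) → p (P ⊗ₜ word n l))
    (t : ↥A ⊗[ℚ] ↥(EG n G)) : p (incl A (EG n G) t) := by
  induction t using TensorProduct.induction_on with
  | zero => simpa using h0
  | tmul P Q =>
    have hQ : (Q : E n) ∈ (EG n G).toSubmodule := Q.2
    have key : ∀ Q : E n, Q ∈ (EG n G).toSubmodule → ∀ P : E n, p (P ⊗ₜ Q) := by
      intro Q hQ
      rw [EG_eq_span] at hQ
      induction hQ using Submodule.span_induction with
      | mem a h =>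
        obtain ⟨l, hl, rfl⟩ := h
        exact fun P => hb P l hl
      | zero => intro P; simpa using h0
      | add a b _ _ h1 h2 => intro P; rw [TensorProduct.tmul_add]; exact ha _ _ (h1 P) (h2 P)
      | smul c a _ h => intro P; rw [← TensorProduct.smul_tmul]; exact h _
    exact key Q hQ P
  | add a b h1 h2 => rw [map_add]; exact ha _ _ h1 h2

theorem mulMap_injective (s : Setoid (Fin n)) (G₁ G₂ : SimpleGraph (Fin n))
    (h1 : ∀ i j, G₁.Adj i j → ¬ s i j) (h2 : ∀ i j, G₂.Adj i j → s i j) :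
    Function.Injective (mulMap n (EG n G₁) (EG n G₂)) := by
  apply inj_of_ker
  intro t ht
  have hT : T s (incl _ _ t) = 0 := by rw [T_incl s G₁ h1, ht, map_zero, map_zero]
  have hc : ∀ d e, e ≤ d → cmp n d (T s (cmp n e (incl (EG n G₁) (EG n G₂) t))) =
      if e = d then cmp n d (incl (EG n G₁) (EG n G₂) t) else 0 := by
    intro d e hed
    refine incl_ind (EG n G₁) G₂ (fun z => cmp n d (T s (cmp n e z)) =
      if e = d then cmp n d z else 0) ?_ ?_ ?_ t
    · simp
    · intro a b ha hb
      simp only [map_add, ha, hb]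
      split_ifs <;> simp
    · intro P l hl
      have e0 : ∀ e, cmp n e (P ⊗ₜ word n l) = if l.length = e then P ⊗ₜ word n l else 0 := by
        intro e
        rw [cmp, LinearMap.lTensor_tmul, comp_word]
        split_ifs <;> simp
      rw [e0, e0]
      by_cases hle : l.length = e
      · rw [if_pos hle, cmp_T_word s P l (fun p hp => h2 _ _ (hl p hp)) d (by omega), hle]
        split_ifs <;> rfl
      · rw [if_neg hle]
        split_ifs <;> first | omega | simp
  have hN : ∃ N, ∀ M, N ≤ M → incl (EG n G₁) (EG n G₂) t =
      ∑ d ∈ Finset.range M, cmp n d (incl (EG n G₁) (EG n G₂) t) := by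
    refine incl_ind (EG n G₁) G₂ (fun z => ∃ N, ∀ M, N ≤ M → z =
      ∑ d ∈ Finset.range M, cmp n d z) ?_ ?_ ?_ t
    · exact ⟨0, by simp⟩
    · rintro a b ⟨N, ha⟩ ⟨N', hb⟩
      refine ⟨max N N', fun M hM => ?_⟩
      simp only [map_add, Finset.sum_add_distrib]
      rw [← ha M (le_trans (le_max_left _ _) hM), ← hb M (le_trans (le_max_right _ _) hM)]
    · intro P l hl
      refine ⟨l.length + 1, fun M hM => ?_⟩
      rw [Finset.sum_eq_single l.length]
      · simp [cmp, comp_word]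
      · intro d _ hd
        simp [cmp, comp_word, Ne.symm hd]
      · intro h
        exact absurd (Finset.mem_range.2 (by omega)) h
  obtain ⟨N, hN⟩ := hN
  replace hN := hN N le_rfl
  have : incl (EG n G₁) (EG n G₂) t = 0 := by
    generalize incl (EG n G₁) (EG n G₂) t = z at *
    induction N with
    | zero => simpa using hN
    | succ M ih =>
      apply ih
      have h0 : cmp n M z = 0 := by
        have h3 : cmp n M (T s z) = 0 := by rw [hT, map_zero]
        rw [hN, map_sum, map_sum, Finset.sum_eq_single M] at h3
        · rw [hc M M le_rfl, if_pos rfl] at h3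
          exact h3
        · intro e he hne
          have := Finset.mem_range.1 he
          rw [hc M e (by omega), if_neg hne]
        · intro h
          exact absurd (Finset.mem_range.2 (by omega)) h
      rw [Finset.sum_range_succ, h0, add_zero] at hN
      exact hN
  exact incl_injective _ _ (this.trans (LinearMap.map_zero _).symm)

/-! ### Surjectivity -/

theorem neg_one_smul_cancel {a b c : E n} (h : a + b + c = 0) :
    a = (-1 : ℚ) • b + (-1 : ℚ) • c := by
  have e : a + (b + c) = 0 := by rw [← add_assoc]; exact h
  have h2 := eq_neg_of_add_eq_zero_left e
  rw [h2]
  module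

/-- Moving an edge of `G₂` past elements of `E_{G₁}`. -/
theorem move (G₁ G₂ : SimpleGraph (Fin n))
    (hdisj : ∀ i j : Fin n, ¬ (G₁.Adj i j ∧ G₂.Adj i j))
    (hn : ∀ u v, G₂.Adj u v → ∀ w, G₁.Adj u w → G₁.Adj v w)
    (a b : Fin n) (hab : G₂.Adj a b) {P : E n} (hP : P ∈ EG n G₁) :
    ∃ P' ∈ EG n G₁, ∃ P'' ∈ EG n G₁, x n a b * P = P' + P'' * x n a b := by
  -- the basic case: the edge `c d` of `G₁` with `c = b`
  have base : ∀ a b c, G₂.Adj a b → G₁.Adj b c →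
      ∃ P' ∈ EG n G₁, ∃ P'' ∈ EG n G₁, x n a b * x n b c = P' + P'' * x n a b := by
    intro a b c hab hbc
    have hac : G₁.Adj a c := hn b a hab.symm c hbc
    have hc := x_cyc a b c (by
      simp only [List.nodup_cons, List.mem_cons, List.not_mem_nil, or_false, not_or]
      exact ⟨⟨hab.ne, hac.ne⟩, hbc.ne, by simp⟩)
    refine ⟨(-1 : ℚ) • (x n b c * x n c a), ?_, (-1 : ℚ) • x n c a, ?_, ?_⟩
    · exact Subalgebra.smul_mem _ (mul_mem (x_mem_EG hbc) (x_mem_EG hac.symm)) _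
    · exact Subalgebra.smul_mem _ (x_mem_EG hac.symm) _
    · rw [smul_mul_assoc]
      exact neg_one_smul_cancel hc
  -- flipping the sign of one of the generators
  have flip1 : ∀ a b : Fin n, ∀ Q : E n,
      (∃ P' ∈ EG n G₁, ∃ P'' ∈ EG n G₁, x n a b * Q = P' + P'' * x n a b) →
      ∃ P' ∈ EG n G₁, ∃ P'' ∈ EG n G₁, x n b a * Q = P' + P'' * x n b a := by
    rintro a b Q ⟨P', h', P'', h'', e⟩
    refine ⟨(-1 : ℚ) • P', Subalgebra.smul_mem _ h' _, P'', h'', ?_⟩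
    rw [x_anti a b, smul_mul_assoc, e, smul_add, mul_smul_comm]
  have flip2 : ∀ a b c d : Fin n,
      (∃ P' ∈ EG n G₁, ∃ P'' ∈ EG n G₁, x n a b * x n c d = P' + P'' * x n a b) →
      ∃ P' ∈ EG n G₁, ∃ P'' ∈ EG n G₁, x n a b * x n d c = P' + P'' * x n a b := by
    rintro a b c d ⟨P', h', P'', h'', e⟩
    refine ⟨(-1 : ℚ) • P', Subalgebra.smul_mem _ h' _, (-1 : ℚ) • P'',
      Subalgebra.smul_mem _ h'' _, ?_⟩
    rw [x_anti c d, mul_smul_comm, e, smul_add, smul_mul_assoc]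
  induction hP using Algebra.adjoin_induction with
  | mem y hy =>
    obtain ⟨c, d, hcd, rfl⟩ := hy
    by_cases h1 : b = c
    · subst h1; exact base a b d hab hcd
    by_cases h2 : b = d
    · subst h2; exact flip2 _ _ _ _ (base a b c hab hcd.symm)
    by_cases h3 : a = c
    · subst h3; exact flip1 _ _ _ (base b a d hab.symm hcd)
    by_cases h4 : a = d
    · subst h4; exact flip1 _ _ _ (flip2 _ _ _ _ (base b a c hab.symm hcd.symm))
    refine ⟨0, zero_mem _, x n c d, x_mem_EG hcd, ?_⟩
    rw [zero_add]
    apply x_comm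
    simp only [List.nodup_cons, List.mem_cons, List.not_mem_nil, or_false, not_or]
    exact ⟨⟨hab.ne, h3, h4⟩, ⟨h1, h2⟩, hcd.ne, by simp⟩
  | algebraMap r =>
    exact ⟨0, zero_mem _, algebraMap ℚ _ r, Subalgebra.algebraMap_mem _ _, by
      rw [zero_add, Algebra.commutes]⟩
  | add P Q _ _ hP hQ =>
    obtain ⟨P', h', P'', h'', e⟩ := hP
    obtain ⟨Q', k', Q'', k'', e'⟩ := hQ
    refine ⟨P' + Q', add_mem h' k', P'' + Q'', add_mem h'' k'', ?_⟩
    rw [mul_add, e, e', add_mul]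
    abel
  | mul P Q _ hQm hP hQ =>
    obtain ⟨P', h', P'', h'', e⟩ := hP
    obtain ⟨Q', k', Q'', k'', e'⟩ := hQ
    refine ⟨P' * Q + P'' * Q', add_mem (mul_mem h' hQm) (mul_mem h'' k'), P'' * Q'',
      mul_mem h'' k'', ?_⟩
    rw [← mul_assoc, e, add_mul, mul_assoc P'' (x n a b), e', mul_add, add_assoc, mul_assoc]

theorem mulMap_range (G G₁ G₂ : SimpleGraph (Fin n))
    (hunion : ∀ i j : Fin n, G.Adj i j ↔ (G₁.Adj i j ∨ G₂.Adj i j))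
    (hdisj : ∀ i j : Fin n, ¬ (G₁.Adj i j ∧ G₂.Adj i j))
    (hn : ∀ u v, G₂.Adj u v → ∀ w, G₁.Adj u w → G₁.Adj v w) :
    LinearMap.range (mulMap n (EG n G₁) (EG n G₂)) = (EG n G).toSubmodule := by
  have le1 : EG n G₁ ≤ EG n G := EG_mono fun i j h => (hunion i j).2 (Or.inl h)
  have le2 : EG n G₂ ≤ EG n G := EG_mono fun i j h => (hunion i j).2 (Or.inr h)
  apply le_antisymm
  · rintro _ ⟨t, rfl⟩
    induction t using TensorProduct.induction_on with
    | zero => rw [LinearMap.map_zero]; exact zero_mem _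
    | tmul P Q =>
      rw [mulMap_tmul]
      exact (EG n G).mul_mem (le1 P.2) (le2 Q.2)
    | add a b ha hb => rw [map_add]; exact add_mem ha hb
  · rw [EG_eq_span, Submodule.span_le]
    rintro _ ⟨l, hl, rfl⟩
    have hpq : ∀ P Q : E n, P ∈ EG n G₁ → Q ∈ EG n G₂ →
        P * Q ∈ LinearMap.range (mulMap n (EG n G₁) (EG n G₂)) :=
      fun P Q hP hQ => ⟨⟨P, hP⟩ ⊗ₜ ⟨Q, hQ⟩, rfl⟩
    induction l with
    | nil =>
      have := hpq 1 1 (one_mem _) (one_mem _)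
      simpa using this
    | cons p l ih =>
      obtain ⟨t, ht⟩ := ih (fun q hq => hl q (List.mem_cons_of_mem _ hq))
      rw [word_cons, ← ht]
      clear ht
      induction t using TensorProduct.induction_on with
      | zero => rw [LinearMap.map_zero, mul_zero]; exact zero_mem _
      | tmul P Q =>
        rw [mulMap_tmul, ← mul_assoc]
        rcases (hunion _ _).1 (hl p (by simp)) with h | h
        · exact hpq _ _ (mul_mem (x_mem_EG h) P.2) Q.2
        · obtain ⟨P', h', P'', h'', e⟩ := move G₁ G₂ hdisj hn p.1 p.2 h P.2
          rw [e, add_mul, mul_assoc]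
          exact add_mem (hpq _ _ h' Q.2) (hpq _ _ h'' (mul_mem (x_mem_EG h) Q.2))
      | add a b ha hb => rw [map_add, mul_add]; exact add_mem ha hb

/-! ### Dimensions -/

/-- The inclusion of a graded piece. -/
def degIncl (G : SimpleGraph (Fin n)) (d : ℕ) : EGdeg n G d →ₗ[ℚ] EG n G where
  toFun a := ⟨a, a.2.1⟩
  map_add' _ _ := rfl
  map_smul' _ _ := rfl

/-- The sum of the multiplication maps on the graded pieces. -/
noncomputable def gradedMul (G₁ G₂ : SimpleGraph (Fin n)) (d : ℕ) :
    ((i : Fin (d + 1)) → (EGdeg n G₁ i ⊗[ℚ] EGdeg n G₂ (d - i))) →ₗ[ℚ] E n :=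
  ∑ i : Fin (d + 1), mulMap n (EG n G₁) (EG n G₂) ∘ₗ
    TensorProduct.map (degIncl G₁ i) (degIncl G₂ (d - i)) ∘ₗ LinearMap.proj i

theorem gradedMul_apply (G₁ G₂ : SimpleGraph (Fin n)) (d : ℕ)
    (t : (i : Fin (d + 1)) → (EGdeg n G₁ i ⊗[ℚ] EGdeg n G₂ (d - i))) :
    gradedMul G₁ G₂ d t = ∑ i : Fin (d + 1), mulMap n (EG n G₁) (EG n G₂)
      (TensorProduct.map (degIncl G₁ i) (degIncl G₂ (d - i)) (t i)) := by
  simp [gradedMul]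

theorem gradedMul_injective (G₁ G₂ : SimpleGraph (Fin n))
    (hinj : Function.Injective (mulMap n (EG n G₁) (EG n G₂))) (d : ℕ) :
    Function.Injective (gradedMul G₁ G₂ d) := by
  apply inj_of_ker
  intro t ht
  rw [gradedMul_apply, ← map_sum] at ht
  have h0 := hinj (ht.trans (LinearMap.map_zero _).symm)
  funext j
  have h1 := congrArg (fun z => cmp n (d - j) (incl _ _ z)) h0
  simp only [map_sum] at h1
  have h2 : ∀ i : Fin (d + 1), ∀ z : EGdeg n G₁ i ⊗[ℚ] EGdeg n G₂ (d - i),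
      cmp n (d - j) (incl _ _ (TensorProduct.map (degIncl G₁ i) (degIncl G₂ (d - i)) z)) =
      if i = j then TensorProduct.map (EGdeg n G₁ i).subtype (EGdeg n G₂ (d - i)).subtype z
        else 0 := by
    intro i z
    induction z using TensorProduct.induction_on with
    | zero => simp only [LinearMap.map_zero, ite_self]
    | tmul P Q =>
      have e : cmp n (d - j) ((P : E n) ⊗ₜ (Q : E n)) =
          if i = j then (P : E n) ⊗ₜ[ℚ] (Q : E n) else 0 := by
        rw [cmp, LinearMap.lTensor_tmul, comp_of_mem Q.2.2]
        by_cases hij : i = j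
        · subst hij; simp
        · rw [if_neg hij, if_neg, TensorProduct.tmul_zero]
          intro h
          apply hij
          ext
          omega
      exact e
    | add a b ha hb =>
      simp only [map_add, ha, hb]
      split_ifs <;> simp
  simp only [h2] at h1
  rw [Finset.sum_ite_eq' Finset.univ j, if_pos (Finset.mem_univ _)] at h1
  have h3 : Function.Injective
      (TensorProduct.map (EGdeg n G₁ j).subtype (EGdeg n G₂ (d - j)).subtype) := by
    apply TensorProduct.map_injective_of_flat_flat
    · exact Subtype.val_injective
    · exact Subtype.val_injective
  apply h3
  rw [h1]
  simp only [Pi.zero_apply, LinearMap.map_zero]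

theorem gradedMul_range (G G₁ G₂ : SimpleGraph (Fin n))
    (hr : LinearMap.range (mulMap n (EG n G₁) (EG n G₂)) = (EG n G).toSubmodule) (d : ℕ) :
    LinearMap.range (gradedMul G₁ G₂ d) = EGdeg n G d := by
  apply le_antisymm
  · rintro _ ⟨t, rfl⟩
    rw [gradedMul_apply]
    refine Submodule.sum_mem _ fun i _ => ⟨?_, ?_⟩
    · rw [← hr]; exact ⟨_, rfl⟩
    · generalize t i = z
      induction z using TensorProduct.induction_on with
      | zero => simp only [LinearMap.map_zero]; exact zero_mem _
      | tmul P Q =>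
        have := degSpan_mul P.2.2 Q.2.2
        rw [Nat.add_sub_cancel' (by omega)] at this
        exact this
      | add a b ha hb => rw [map_add, map_add]; exact add_mem ha hb
  · rintro y ⟨hy, hyd⟩
    rw [SetLike.mem_coe, ← hr] at hy
    obtain ⟨t, rfl⟩ := hy
    have e := comp_of_mem hyd d
    rw [if_pos rfl] at e
    rw [← e]
    clear e hyd
    induction t using TensorProduct.induction_on with
    | zero => simp only [LinearMap.map_zero]; exact zero_mem _
    | tmul P Q =>
      rw [mulMap_tmul, comp_mul]
      refine Submodule.sum_mem _ fun p hp => ?_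
      have hp' := Finset.HasAntidiagonal.mem_antidiagonal.1 hp
      obtain ⟨i, j⟩ := p
      obtain rfl : j = d - i := by simp at hp'; omega
      have hi : i < d + 1 := by simp at hp'; omega
      refine ⟨Pi.single (⟨i, hi⟩ : Fin (d + 1))
        ((⟨_, comp_mem G₁ i P.2⟩ : EGdeg n G₁ i) ⊗ₜ[ℚ]
          (⟨_, comp_mem G₂ (d - i) Q.2⟩ : EGdeg n G₂ (d - i))), ?_⟩
      rw [gradedMul_apply, Finset.sum_eq_single (⟨i, hi⟩ : Fin (d + 1))]
      · rw [Pi.single_eq_same]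
        rfl
      · intro k _ hk
        rw [Pi.single_eq_of_ne hk]
        simp only [LinearMap.map_zero]
      · simp
    | add a b ha hb => rw [map_add, map_add]; exact add_mem ha hb

theorem finrank_pi_rat {m : ℕ} (M : Fin m → Type) [∀ i, AddCommMonoid (M i)]
    [∀ i, Module ℚ (M i)] [∀ i, Module.Finite ℚ (M i)] :
    Module.finrank ℚ (∀ i, M i) = ∑ i, Module.finrank ℚ (M i) := by
  letI := fun i => Module.addCommMonoidToAddCommGroup ℚ (M := M i)
  exact Module.finrank_pi_fintype ℚ

theorem finrank_graded (G G₁ G₂ : SimpleGraph (Fin n))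
    (hinj : Function.Injective (mulMap n (EG n G₁) (EG n G₂)))
    (hr : LinearMap.range (mulMap n (EG n G₁) (EG n G₂)) = (EG n G).toSubmodule) (d : ℕ) :
    Module.finrank ℚ ↥(EGdeg n G d) = ∑ i ∈ Finset.range (d + 1),
        Module.finrank ℚ ↥(EGdeg n G₁ i) * Module.finrank ℚ ↥(EGdeg n G₂ (d - i)) := by
  rw [← gradedMul_range G G₁ G₂ hr d, ← (LinearEquiv.ofInjective (gradedMul G₁ G₂ d)
    (gradedMul_injective G₁ G₂ hinj d)).finrank_eq, finrank_pi_rat, Finset.sum_range]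
  exact Finset.sum_congr rfl fun i _ => Module.finrank_tensorProduct

end Basics

/-- let `G₁`, `G₂` be subgraphs of `G` whose edge sets partition the edges
of `G`, such that any two vertices in the same connected component of `G₂` have the same
neighbors in `G₁`.  Then the multiplication map `μ : E_{G₁} ⊗_ℚ E_{G₂} → E_G` is a
`ℚ`-linear bijection (injective with image `E_G`); in particular
`dim E_G^d = Σ_{i+j=d} dim E_{G₁}^i · dim E_{G₂}^j`. -/
theorem stmt13 (n : ℕ) (hn : 1 ≤ n) (G G₁ G₂ : SimpleGraph (Fin n))
    (hunion : ∀ i j : Fin n, G.Adj i j ↔ (G₁.Adj i j ∨ G₂.Adj i j))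
    (hdisj : ∀ i j : Fin n, ¬ (G₁.Adj i j ∧ G₂.Adj i j))
    (hnbrs : ∀ u v : Fin n, G₂.Reachable u v →
      ∀ w : Fin n, G₁.Adj u w ↔ G₁.Adj v w) :
    Function.Injective (mulMap n (EG n G₁) (EG n G₂)) ∧
    LinearMap.range (mulMap n (EG n G₁) (EG n G₂)) = (EG n G).toSubmodule ∧
    (∀ d : ℕ, Module.finrank ℚ ↥(EGdeg n G d) =
      ∑ i ∈ Finset.range (d + 1),
        Module.finrank ℚ ↥(EGdeg n G₁ i) * Module.finrank ℚ ↥(EGdeg n G₂ (d - i))) := by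
  have hn' : ∀ u v, G₂.Adj u v → ∀ w, G₁.Adj u w → G₁.Adj v w :=
    fun u v h w hw => (hnbrs u v h.reachable w).1 hw
  have hinj := mulMap_injective G₂.reachableSetoid G₁ G₂
    (fun i j h hij => (G₁.irrefl ((hnbrs i j hij j).1 h)).elim)
    (fun i j h => h.reachable)
  have hr := mulMap_range G G₁ G₂ hunion hdisj hn'
  exact ⟨hinj, hr, finrank_graded G G₁ G₂ hinj hr⟩

end FK
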